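/- Fix an integer n ≥ 3 and let v ∈ ℤ^n be the vector with v_1 = 2n−2 and v_s = 2(n−s)+1 for 2 ≤ s ≤ n. For all indices 1 < i < j ≤ n and every integer m with 1 ≤ m ≤ (n−i) + (n−j), the vector u = v − 2m(e_i + e_j) has two indices s < t with |u_s| = |u_t|. -/

import Mathlib

/-- Case 1 of the proof of Proposition 6.6.  Let `n ≥ 3` and let `v ∈ ℤ^n` be the
vector with `v_1 = 2n-2` and `v_s = 2(n-s)+1` for `2 ≤ s ≤ n` (in `Fin n` indexing,
paper index `s` corresponds to the coordinate `s-1`).  For all paper indices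
`1 < i < j ≤ n` and every integer `m` with `1 ≤ m ≤ (n-i)+(n-j)`, the vector
`u = v - 2m(e_i + e_j)` has two indices `s < t` with `|u_s| = |u_t|`. -/
theorem case1_eps_add (n : ℕ) (hn : 3 ≤ n) (v : Fin n → ℤ)
    (hv : ∀ s : Fin n,
      v s = if (s : ℕ) = 0 then 2 * (n : ℤ) - 2 else 2 * ((n : ℤ) - ((s : ℕ) + 1)) + 1)
    (i j : Fin n) (hi : 1 ≤ (i : ℕ)) (hij : i < j)
    (m : ℤ) (hm1 : 1 ≤ m)
    (hm2 : m ≤ ((n : ℤ) - ((i : ℕ) + 1)) + ((n : ℤ) - ((j : ℕ) + 1))) :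
    ∃ s t : Fin n, s < t ∧
      |((v - (2 * m) • (Pi.single i (1 : ℤ) + Pi.single j 1) : Fin n → ℤ)) s| =
        |((v - (2 * m) • (Pi.single i (1 : ℤ) + Pi.single j 1) : Fin n → ℤ)) t| := by
  have hij' : (i : ℕ) < (j : ℕ) := hij
  have hjn := j.isLt
  set u : Fin n → ℤ := v - (2 * m) • (Pi.single i (1 : ℤ) + Pi.single j 1) with hu
  have hui : u i = 2 * ((n : ℤ) - ((i : ℕ) + 1)) + 1 - 2 * m := by
    have h : i ≠ j := ne_of_lt hij
    have h0 : (i : ℕ) ≠ 0 := by omega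
    simp [hu, hv, Pi.single_apply, h, h0]
  have huj : u j = 2 * ((n : ℤ) - ((j : ℕ) + 1)) + 1 - 2 * m := by
    have h : j ≠ i := ne_of_gt hij
    have h0 : (j : ℕ) ≠ 0 := by omega
    simp [hu, hv, Pi.single_apply, h, h0]
  have huc : ∀ s : Fin n, (s : ℕ) ≠ 0 → (s : ℕ) ≠ i → (s : ℕ) ≠ j →
      u s = 2 * ((n : ℤ) - ((s : ℕ) + 1)) + 1 := by
    intro s h0 h1 h2
    have h1' : s ≠ i := fun h => h1 (by rw [h])
    have h2' : s ≠ j := fun h => h2 (by rw [h])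
    simp [hu, hv, Pi.single_apply, h0, h1', h2']
  clear_value u
  have key : ∀ s t : Fin n, s ≠ t → |u s| = |u t| → ∃ s t : Fin n, s < t ∧ |u s| = |u t| := by
    intro s t hne h
    rcases lt_or_gt_of_ne hne with h' | h'
    · exact ⟨s, t, h', h⟩
    · exact ⟨t, s, h', h.symm⟩
  -- an index `k` whose coordinate has absolute value `2c+1` with `c` unoccupied
  have coll : ∀ (k : Fin n) (c : ℕ), (k = i ∨ k = j) → c + 2 ≤ n → n - 1 - c ≠ (i : ℕ) →
      n - 1 - c ≠ (j : ℕ) → (u k = 2 * (c : ℤ) + 1 ∨ u k = -(2 * (c : ℤ) + 1)) →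
      ∃ s t : Fin n, s < t ∧ |u s| = |u t| := by
    intro k c hk hc h1 h2 h
    have hs := huc ⟨n - 1 - c, by omega⟩ (by simp only; omega) h1 h2
    refine key k ⟨n - 1 - c, by omega⟩ ?_ ?_
    · rintro rfl
      rcases hk with hk | hk
      · exact h1 (congrArg Fin.val hk)
      · exact h2 (congrArg Fin.val hk)
    · rw [abs_eq_abs, hs]
      simp only
      omega
  by_cases hm : m = (j : ℤ) - (i : ℤ)
  · by_cases hb : (n : ℤ) - 1 - i = 3 * ((n : ℤ) - 1 - j) + 1
    · exact key i j (ne_of_lt hij) (by rw [abs_eq_abs]; omega)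
    · by_cases hc : (0 : ℤ) ≤ (n : ℤ) - 1 - j - m
      · exact coll j ((n : ℤ) - 1 - j - m).toNat (Or.inr rfl) (by omega) (by omega) (by omega)
          (by omega)
      · exact coll j (m - 1 - ((n : ℤ) - 1 - j)).toNat (Or.inr rfl) (by omega) (by omega)
          (by omega) (by omega)
  · by_cases hc : (0 : ℤ) ≤ (n : ℤ) - 1 - i - m
    · exact coll i ((n : ℤ) - 1 - i - m).toNat (Or.inl rfl) (by omega) (by omega) (by omega)
        (by omega)
    · exact coll i (m - 1 - ((n : ℤ) - 1 - i)).toNat (Or.inl rfl) (by omega) (by omega)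
        (by omega) (by omega)
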